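/- Let 1 ≤ k < n be integers with n ≤ (3k+1)/2, and let c be an integer with max{0, 2k−n} ≤ c ≤ k−1. Then there exists Q such that for every prime power q ≥ Q: e_q(k,n,c) = e_q(k−c, 2k−c, 0), and every equidistant c-intersecting code C ⊆ G_q(k,n) with |C| = e_q(k,n,c) is of the form C = S^⊥ for some sunflower S ⊆ G_q(n−k, n). -/

import Mathlib

open Submodule Module Set

/-- The orthogonal complement of a subspace of `Fin n → F` with respect to the
standard bilinear form `(x, y) ↦ ∑ i, x i * y i`. -/
def stdOrth {F : Type} [Field F] {n : ℕ} (U : Submodule F (Fin n → F)) :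
    Submodule F (Fin n → F) where
  carrier := {x | ∀ y ∈ U, ∑ i, x i * y i = 0}
  add_mem' := by
    intro a b ha hb y hy
    simp only [Set.mem_setOf_eq] at *
    simp [add_mul, Finset.sum_add_distrib, ha y hy, hb y hy]
  zero_mem' := by intro y hy; simp
  smul_mem' := by
    intro c a ha y hy
    simp only [Set.mem_setOf_eq] at *
    simp [smul_eq_mul, mul_assoc, ← Finset.mul_sum, ha y hy]

/-- An equidistant `c`-intersecting subspace code of constant dimension `k` in `F^n`:
a set of at least two `k`-dimensional subspaces, any two distinct members of which
intersect in dimension `c`. -/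
def IsEquidistantCode (F : Type) [Field F] (n k c : ℕ)
    (C : Set (Submodule F (Fin n → F))) : Prop :=
  2 ≤ C.ncard ∧ (∀ U ∈ C, Module.finrank F U = k) ∧
    ∀ U ∈ C, ∀ V ∈ C, U ≠ V → Module.finrank F ↥(U ⊓ V) = c

/-- A set of subspaces is a sunflower if there is a common center `Z` equal to the
intersection of any two distinct members. -/
def IsSunflower {F : Type} [Field F] {n : ℕ} (C : Set (Submodule F (Fin n → F))) : Prop :=
  ∃ Z : Submodule F (Fin n → F), ∀ U ∈ C, ∀ V ∈ C, U ≠ V → U ⊓ V = Z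

/-- `eMax F n k c` is the maximum cardinality of an equidistant `c`-intersecting
code of constant dimension `k` in `F^n`. -/
noncomputable def eMax (F : Type) [Field F] (n k c : ℕ) : ℕ :=
  sSup {m | ∃ C : Set (Submodule F (Fin n → F)), IsEquidistantCode F n k c C ∧ C.ncard = m}

section A
variable {F V : Type} [Field F] [Fintype F] [AddCommGroup V] [Module F V] [Fintype V]

open Classical in
theorem var_identity (C : Finset (Submodule F V)) (K L : ℤ)
    (hK : ∀ U ∈ C, ∑ y : V, (if y ∈ U then (1:ℤ) else 0) = K)
    (hL : ∀ U ∈ C, ∀ W ∈ C, U ≠ W → ∑ y : V, (if y ∈ U ⊓ W then (1:ℤ) else 0) = L)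
    (w : Submodule F V → ℤ) :
    ∑ y : V, (∑ U ∈ C, w U * (if y ∈ U then 1 else 0))^2
      = L * (∑ U ∈ C, w U)^2 + (K - L) * ∑ U ∈ C, w U ^2 := by
  have h1 : ∀ y : V, (∑ U ∈ C, w U * (if y ∈ U then (1:ℤ) else 0))^2
      = ∑ U ∈ C, ∑ W ∈ C, w U * w W * (if y ∈ U ⊓ W then 1 else 0) := by
    intro y
    rw [sq, Finset.sum_mul_sum]
    refine Finset.sum_congr rfl fun U _ => Finset.sum_congr rfl fun W _ => ?_
    by_cases h1 : y ∈ U <;> by_cases h2 : y ∈ W <;> simp [h1, h2]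
  simp_rw [h1]
  rw [Finset.sum_comm]
  have h2 : ∀ U ∈ C, ∑ y : V, ∑ W ∈ C, w U * w W * (if y ∈ U ⊓ W then (1:ℤ) else 0)
      = L * (w U * ∑ W ∈ C, w W) + (K - L) * w U ^ 2 := by
    intro U hU
    rw [Finset.sum_comm]
    have : ∀ W ∈ C, ∑ y : V, w U * w W * (if y ∈ U ⊓ W then (1:ℤ) else 0)
        = L * (w U * w W) + (if U = W then (K - L) * w U ^ 2 else 0) := by
      intro W hW
      rw [← Finset.mul_sum]
      by_cases h : U = W
      · subst h
        rw [inf_idem, hK U hU]; simp; ring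
      · rw [hL U hU W hW h]; simp [h]; ring
    rw [Finset.sum_congr rfl this, Finset.sum_add_distrib, Finset.sum_ite_eq]
    simp [hU, Finset.mul_sum]
  rw [Finset.sum_congr rfl h2, Finset.sum_add_distrib, ← Finset.mul_sum, ← Finset.mul_sum,
    ← Finset.sum_mul]
  ring

open Classical in
theorem var_bound (C : Finset (Submodule F V)) (K L : ℤ)
    (hK : ∀ U ∈ C, ∑ y : V, (if y ∈ U then (1:ℤ) else 0) = K)
    (hL : ∀ U ∈ C, ∀ W ∈ C, U ≠ W → ∑ y : V, (if y ∈ U ⊓ W then (1:ℤ) else 0) = L)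
    (x : V) (hx : x ≠ 0) (N M : ℤ) (hN : N = (C.filter (x ∈ ·)).card)
    (hM : M = (C.filter (x ∉ ·)).card) :
    ((Fintype.card F : ℤ) - 1) * (M * N)^2 ≤ (K - L) * (M * N * (M + N)) := by
  have h := var_identity C K L hK hL (fun U => if x ∈ U then M else - N)
  have e1 : ∑ U ∈ C, (if x ∈ U then M else - N) = 0 := by
    rw [Finset.sum_ite]; simp [← hN, ← hM]; ring
  have e2 : ∑ U ∈ C, (if x ∈ U then M else - N)^2 = M * N * (M + N) := by
    simp_rw [ite_pow]
    rw [Finset.sum_ite]; simp [← hN, ← hM]; ring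
  simp only [e1, e2] at h
  have h3 : ((Fintype.card F : ℤ) - 1) * (M * N)^2 = ∑ y ∈ (Finset.univ.filter (fun a : F => a ≠ 0)).image (fun a => a • x),
     (∑ U ∈ C, (if x ∈ U then M else - N) * (if y ∈ U then 1 else 0))^2 := by
    rw [Finset.sum_image]
    · have : ∀ a ∈ Finset.univ.filter (fun a : F => a ≠ 0), (∑ U ∈ C, (if x ∈ U then M else - N) * (if a • x ∈ U then 1 else 0))^2 = (M * N)^2 := by
        intro a ha
        have ha : a ≠ 0 := by simpa using ha
        have : ∀ U ∈ C, (if x ∈ U then M else - N) * (if a • x ∈ U then 1 else 0) = if x ∈ U then M else 0 := by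
          intro U _
          rw [Submodule.smul_mem_iff _ ha]
          by_cases h : x ∈ U <;> simp [h]
        rw [Finset.sum_congr rfl this, Finset.sum_ite]
        simp [← hN]; ring
      rw [Finset.sum_congr rfl this]
      have hc : (Finset.univ.filter (fun a : F => a ≠ 0)).card = Fintype.card F - 1 := by
        rw [Finset.filter_ne', Finset.card_erase_of_mem (Finset.mem_univ _), Finset.card_univ]
      rw [Finset.sum_const, hc, nsmul_eq_mul, Nat.cast_sub Fintype.card_pos]
      simp
    · intro a _ b _ hab
      exact smul_left_injective F hx hab
  rw [h3]
  calc _ ≤ _ := Finset.sum_le_sum_of_subset_of_nonneg (Finset.subset_univ _) (fun _ _ _ => sq_nonneg _)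
    _ = _ := by rw [h]; ring
end A

section B
variable {F V : Type} [Field F] [Fintype F] [AddCommGroup V] [Module F V] [Fintype V]

open Classical in
theorem card_ind (U : Submodule F V) :
    ∑ y : V, (if y ∈ U then (1:ℕ) else 0) = Fintype.card F ^ finrank F U := by
  have : FiniteDimensional F V := Module.Finite.of_finite
  rw [Finset.sum_boole]
  have := Module.natCard_eq_pow_finrank (K := F) (V := U)
  rw [Nat.card_eq_fintype_card, Nat.card_eq_fintype_card] at this
  rw [← this, Fintype.card_subtype]; simp

open Classical in
theorem deg_dichotomy (C : Finset (Submodule F V)) (k c : ℕ) (hk : 1 ≤ k)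
    (hdim : ∀ U ∈ C, finrank F U = k)
    (hint : ∀ U ∈ C, ∀ W ∈ C, U ≠ W → finrank F ↥(U ⊓ W) = c) (x : V) :
    (C.filter (x ∈ ·)).card ≤ 4 * Fintype.card F ^ (k-1) ∨
    (C.filter (x ∉ ·)).card ≤ 4 * Fintype.card F ^ (k-1) := by
  by_cases hx : x = 0
  · right; subst hx; simp
  have hb := var_bound C ((Fintype.card F : ℤ)^k) ((Fintype.card F : ℤ)^c)
    (by intro U hU; have := card_ind U; rw [hdim U hU] at this; exact_mod_cast this)
    (by intro U hU W hW h; have := card_ind (U ⊓ W); rw [hint U hU W hW h] at this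
        exact_mod_cast this) x hx _ _ rfl rfl
  have hq : (2:ℤ) ≤ Fintype.card F := by exact_mod_cast Fintype.one_lt_card
  set N := (C.filter (x ∈ ·)).card
  set M := (C.filter (x ∉ ·)).card
  set q := Fintype.card F
  obtain ⟨j, rfl⟩ : ∃ j, k = j + 1 := ⟨k - 1, by omega⟩
  simp only [Nat.add_sub_cancel]
  rcases Nat.eq_zero_or_pos N with h0 | hN
  · left; omega
  rcases Nat.eq_zero_or_pos M with h0 | hM
  · right; omega
  have hN' : (0:ℤ) < N := by exact_mod_cast hN
  have hM' : (0:ℤ) < M := by exact_mod_cast hM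
  have h1 : ((q:ℤ) - 1) * (M * N) ≤ (q:ℤ)^(j+1) * (M + N) := by
    have hp : (0:ℤ) < M * N := by positivity
    have h2 : (((q:ℤ) - 1) * (M * N)) * (M * N) ≤ ((q:ℤ)^(j+1) * (M + N)) * (M * N) := by
      have : (0:ℤ) ≤ (q:ℤ)^c * (M * N * (M + N)) := by positivity
      nlinarith
    exact le_of_mul_le_mul_right h2 hp
  have key : ∀ a b : ℤ, 0 < a → 0 < b → a ≤ b → ((q:ℤ) - 1) * (b * a) ≤ (q:ℤ)^(j+1) * (b + a) →
      a ≤ 4 * (q:ℤ)^j := by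
    intro a b ha hb' hab h
    have hqj : (0:ℤ) < (q:ℤ)^j := by positivity
    have h3 : b * (((q:ℤ) - 1) * a) ≤ b * (2 * (q:ℤ)^(j+1)) := by
      have : (q:ℤ)^(j+1) * (b + a) ≤ (q:ℤ)^(j+1) * (b + b) := by gcongr
      nlinarith
    have h4 := le_of_mul_le_mul_left h3 hb'
    have h5 : (q:ℤ) * a ≤ (q:ℤ) * (4 * (q:ℤ)^j) := by
      rw [pow_succ] at h4; nlinarith
    exact le_of_mul_le_mul_left h5 (by linarith)
  rcases le_total N M with h | h
  · left; exact_mod_cast key N M hN' hM' (by exact_mod_cast h) h1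
  · right; exact_mod_cast key M N hM' hN' (by exact_mod_cast h) (by linarith)

open Classical in
theorem large_is_sunflower (C : Finset (Submodule F V)) (k c : ℕ) (hck : c < k)
    (hdim : ∀ U ∈ C, finrank F U = k)
    (hint : ∀ U ∈ C, ∀ W ∈ C, U ≠ W → finrank F ↥(U ⊓ W) = c)
    (hq : 4 * (k + 2) ≤ Fintype.card F) (hT : Fintype.card F ^ (2*k-1) ≤ C.card) :
    ∃ Z : Submodule F V, ∀ U ∈ C, ∀ W ∈ C, U ≠ W → U ⊓ W = Z := by
  have : FiniteDimensional F V := Module.Finite.of_finite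
  rcases Nat.eq_zero_or_pos c with rfl | hc
  · exact ⟨⊥, fun U hU W hW h => Submodule.finrank_eq_zero.1 (hint U hU W hW h)⟩
  have hdich := deg_dichotomy C k c (by omega) hdim hint
  set q := Fintype.card F with hqdef
  set B := 4 * q^(k-1) with hB
  have hqpos : 0 < q := by omega
  have hBpos : 4 ≤ B := by have : 0 < q^(k-1) := by positivity
                           omega
  have hTB : (k+2) * B ≤ C.card := by
    refine le_trans ?_ hT
    calc (k+2) * B = (4 * (k+2)) * q^(k-1) := by rw [hB]; ring
      _ ≤ q * q^(k-1) := by gcongr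
      _ = q^(k-1+1) := by ring
      _ ≤ q^(2*k-1) := Nat.pow_le_pow_right hqpos (by omega)
  have hsplit : ∀ x : V, (C.filter (x ∈ ·)).card + (C.filter (x ∉ ·)).card = C.card :=
    fun x => Finset.card_filter_add_card_filter_not _
  let Z : Submodule F V :=
    { carrier := {x | (C.filter (x ∉ ·)).card ≤ B}
      zero_mem' := by simp
      add_mem' := by
        intro a b ha hb
        simp only [Set.mem_ofPred_eq] at *
        by_contra hcon
        have h1 := (hdich (a+b)).resolve_right hcon
        have h2 : (C.filter (a + b ∉ ·)).card ≤ (C.filter (a ∉ ·)).card + (C.filter (b ∉ ·)).card := by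
          refine le_trans (Finset.card_le_card ?_) (Finset.card_union_le _ _)
          intro U
          simp only [Finset.mem_filter, Finset.mem_union]
          rintro ⟨hU, h⟩
          by_contra h'
          push Not at h'
          exact h (U.add_mem (h'.1 hU) (h'.2 hU))
        have h3 := hsplit (a+b)
        nlinarith
      smul_mem' := by
        intro r a ha
        simp only [Set.mem_ofPred_eq] at *
        refine le_trans (Finset.card_le_card ?_) ha
        intro U
        simp only [Finset.mem_filter]
        rintro ⟨hU, h⟩
        exact ⟨hU, fun h' => h (U.smul_mem _ h')⟩ }
  have hZ : ∀ x, x ∈ Z ↔ (C.filter (x ∉ ·)).card ≤ B := fun x => Iff.rfl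
  have hZU : ∀ U ∈ C, c ≤ finrank F ↥(Z ⊓ U) := by
    intro U hU
    by_contra hlt
    push Not at hlt
    have hs1 : ∑ x : V, (if x ∈ U then (C.filter (x ∈ ·)).card else 0)
        = ∑ W ∈ C, q ^ finrank F ↥(U ⊓ W) := by
      have hci : ∀ W : Submodule F V, q ^ finrank F W = ∑ y : V, (if y ∈ W then (1:ℕ) else 0) :=
        fun W => (card_ind W).symm
      simp_rw [hci, Finset.card_filter]
      rw [Finset.sum_comm]
      refine Finset.sum_congr rfl fun x _ => ?_
      by_cases h : x ∈ U <;> simp [h]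
    have hs2 : C.card * q^c ≤ ∑ W ∈ C, q ^ finrank F ↥(U ⊓ W) := by
      rw [← smul_eq_mul]
      refine Finset.card_nsmul_le_sum _ _ _ fun W hW => ?_
      by_cases h : U = W
      · subst h; rw [inf_idem, hdim U hU]; exact Nat.pow_le_pow_right hqpos hck.le
      · rw [hint U hU W hW h]
    have hs3 : ∑ x : V, (if x ∈ U then (C.filter (x ∈ ·)).card else 0)
        ≤ ∑ x : V, ((if x ∈ Z ⊓ U then 1 else 0) * C.card + (if x ∈ U then 1 else 0) * B) := by
      refine Finset.sum_le_sum fun x _ => ?_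
      by_cases h : x ∈ U
      · by_cases h' : x ∈ Z
        · have := hsplit x
          simp [h, h']; omega
        · have h2 := (hdich x).resolve_right (fun h2 => h' ((hZ x).2 h2))
          simpa [h, h'] using h2
      · simp [h]
    rw [Finset.sum_add_distrib, ← Finset.sum_mul, ← Finset.sum_mul, card_ind, card_ind,
      hdim U hU, hs1] at hs3
    have h4 : q ^ finrank F ↥(Z ⊓ U) ≤ q^(c-1) := Nat.pow_le_pow_right hqpos (by omega)
    have h5 : q^k * B ≤ 4 * C.card := by
      have : q^k * q^(k-1) = q^(2*k-1) := by rw [← pow_add]; congr 1; omega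
      calc q^k * B = 4 * (q^k * q^(k-1)) := by rw [hB]; ring
        _ ≤ _ := by rw [this]; omega
    have h6 : C.card * q^c ≤ C.card * (q^(c-1) + 4) := by
      have : q ^ finrank F ↥(Z ⊓ U) * C.card ≤ q^(c-1) * C.card := by gcongr
      nlinarith
    have hTpos : 0 < C.card := by nlinarith
    have h7 := le_of_mul_le_mul_left h6 hTpos
    have h8 : q^c = q * q^(c-1) := by rw [← pow_succ']; congr 1; omega
    have h9 : 0 < q^(c-1) := by positivity
    nlinarith
  have hZc : finrank F Z ≤ c := by
    by_contra hlt
    push Not at hlt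
    let b := Module.finBasis F Z
    let f : Fin (c+1) → V := fun i => (b (Fin.castLE hlt i) : V)
    have hf : LinearIndependent F f := by
      have h1 := b.linearIndependent.map' Z.subtype Z.ker_subtype
      exact h1.comp _ (Fin.castLE_injective hlt)
    have hfZ : ∀ i, f i ∈ Z := fun i => (b _).2
    have h1 : (C.filter (fun U => ∃ i, f i ∉ U)).card ≤ (c+1) * B := by
      have : C.filter (fun U => ∃ i, f i ∉ U) ⊆
          Finset.univ.biUnion (fun i : Fin (c+1) => C.filter (f i ∉ ·)) := by
        intro U; simp
      refine le_trans (Finset.card_le_card this) ?_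
      refine le_trans (Finset.card_biUnion_le_card_mul _ _ B fun i _ => (hZ _).1 (hfZ i)) ?_
      simp
    have h2 : (C.filter (fun U => ∃ i, f i ∉ U)).card + (C.filter (fun U => ¬ ∃ i, f i ∉ U)).card
        = C.card := Finset.card_filter_add_card_filter_not _
    have h3 : 1 < (C.filter (fun U => ¬ ∃ i, f i ∉ U)).card := by nlinarith
    obtain ⟨U, hU, W, hW, hne⟩ := Finset.one_lt_card.1 h3
    simp only [Finset.mem_filter, not_exists, not_not] at hU hW
    have h4 := hint U hU.1 W hW.1 hne
    have h5 : span F (Set.range f) ≤ U ⊓ W := by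
      rw [span_le]; rintro _ ⟨i, rfl⟩; exact ⟨hU.2 i, hW.2 i⟩
    have h6 := Submodule.finrank_mono h5
    rw [finrank_span_eq_card hf, h4] at h6
    simp at h6
  have hle : ∀ U ∈ C, Z ≤ U := by
    intro U hU
    have : Z ⊓ U = Z := Submodule.eq_of_le_of_finrank_le inf_le_left (hZc.trans (hZU U hU))
    exact inf_eq_left.1 this
  refine ⟨Z, fun U hU W hW h => ?_⟩
  symm
  refine Submodule.eq_of_le_of_finrank_le (le_inf (hle U hU) (hle W hW)) ?_
  rw [hint U hU W hW h]
  have := hZU U hU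
  rwa [inf_eq_left.2 (hle U hU)] at this
end B

section C
variable {F : Type} [Field F]

theorem stdOrth_eq {n : ℕ} (U : Submodule F (Fin n → F)) :
    stdOrth U = LinearMap.BilinForm.orthogonal (dotProductBilin F F : LinearMap.BilinForm F (Fin n → F)) U := by
  ext x
  rw [LinearMap.BilinForm.mem_orthogonal_iff]
  constructor
  · intro h y hy
    have := h y hy
    change y ⬝ᵥ x = 0
    rw [dotProduct_comm]; exact this
  · intro h y hy
    have : y ⬝ᵥ x = 0 := h y hy
    rw [dotProduct_comm] at this; exact this

theorem dot_refl (n : ℕ) :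
    LinearMap.BilinForm.IsRefl (dotProductBilin F F : LinearMap.BilinForm F (Fin n → F)) := by
  intro x y h
  change x ⬝ᵥ y = 0 at h
  change y ⬝ᵥ x = 0
  rw [dotProduct_comm]; exact h

theorem dot_nondeg (n : ℕ) : (dotProductBilin F F : LinearMap.BilinForm F (Fin n → F)).Nondegenerate := by
  constructor
  · intro x h
    exact dotProduct_eq_zero x h
  · intro x h
    exact dotProduct_eq_zero x (fun w => by rw [dotProduct_comm]; exact h w)

theorem stdOrth_stdOrth {n : ℕ} (U : Submodule F (Fin n → F)) : stdOrth (stdOrth U) = U := by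
  rw [stdOrth_eq, stdOrth_eq]
  exact LinearMap.BilinForm.orthogonal_orthogonal (dot_nondeg n) (dot_refl n) U

theorem finrank_stdOrth {n : ℕ} (U : Submodule F (Fin n → F)) :
    finrank F (stdOrth U) = n - finrank F U := by
  rw [stdOrth_eq, LinearMap.BilinForm.finrank_orthogonal (dot_nondeg n)]; simp

theorem stdOrth_sup {n : ℕ} (U W : Submodule F (Fin n → F)) :
    stdOrth (U ⊔ W) = stdOrth U ⊓ stdOrth W := by
  have anti : ∀ A B : Submodule F (Fin n → F), A ≤ B → stdOrth B ≤ stdOrth A :=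
    fun A B h x hx y hy => hx y (h hy)
  apply le_antisymm
  · exact le_inf (anti _ _ le_sup_left) (anti _ _ le_sup_right)
  · have h : U ⊔ W ≤ stdOrth (stdOrth U ⊓ stdOrth W) := by
      refine sup_le ?_ ?_
      · conv_lhs => rw [← stdOrth_stdOrth U]
        exact anti _ _ inf_le_left
      · conv_lhs => rw [← stdOrth_stdOrth W]
        exact anti _ _ inf_le_right
    have := anti _ _ h
    rwa [stdOrth_stdOrth] at this

theorem stdOrth_inj {n : ℕ} : Function.Injective (stdOrth : Submodule F (Fin n → F) → _) :=
  Function.LeftInverse.injective (g := stdOrth) stdOrth_stdOrth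

theorem orth_code {n k c : ℕ} {C : Set (Submodule F (Fin n → F))}
    (hC : IsEquidistantCode F n k c C) :
    IsEquidistantCode F n (n-k) (n+c-2*k) (stdOrth '' C) := by
  obtain ⟨h1, h2, h3⟩ := hC
  refine ⟨by rwa [Set.ncard_image_of_injective _ stdOrth_inj], ?_, ?_⟩
  · rintro _ ⟨U, hU, rfl⟩
    rw [finrank_stdOrth, h2 U hU]
  · rintro _ ⟨U, hU, rfl⟩ _ ⟨W, hW, rfl⟩ hne
    have hne' : U ≠ W := fun h => hne (by rw [h])
    rw [← stdOrth_sup, finrank_stdOrth]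
    have := Submodule.finrank_sup_add_finrank_inf_eq U W
    rw [h2 U hU, h2 W hW, h3 U hU W hW hne'] at this
    omega

theorem finrank_comap_surj {V W : Type} [AddCommGroup V] [Module F V] [AddCommGroup W] [Module F W]
    [FiniteDimensional F V] (f : V →ₗ[F] W) (hf : Function.Surjective f) (U : Submodule F W) :
    finrank F (U.comap f) = finrank F U + finrank F (LinearMap.ker f) := by
  have h := LinearMap.finrank_range_add_finrank_ker (f.domRestrict (U.comap f))
  rw [← h]
  congr 1
  · rw [LinearMap.range_domRestrict, Submodule.map_comap_eq_of_surjective hf]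
  · rw [LinearMap.ker_domRestrict]
    exact (Submodule.submoduleOfEquivOfLe (LinearMap.ker_le_comap f)).finrank_eq

/-- pull back along a surjection. -/
theorem pull_code {n m d e : ℕ} (hn : n = m + e) {D : Set (Submodule F (Fin m → F))}
    (hD : IsEquidistantCode F m d 0 D) :
    ∃ C : Set (Submodule F (Fin n → F)), IsEquidistantCode F n (d + e) e C ∧ C.ncard = D.ncard := by
  let f : (Fin n → F) →ₗ[F] (Fin m → F) := LinearMap.funLeft F F (Fin.castLE (by omega))
  have hf : Function.Surjective f :=
    LinearMap.funLeft_surjective_of_injective F F _ (Fin.castLE_injective _)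
  have hk : finrank F (LinearMap.ker f) = e := by
    have := LinearMap.finrank_range_add_finrank_ker f
    rw [LinearMap.range_eq_top.2 hf] at this
    simp at this; omega
  obtain ⟨h1, h2, h3⟩ := hD
  have hinj := Submodule.comap_injective_of_surjective hf
  refine ⟨Submodule.comap f '' D, ⟨?_, ?_, ?_⟩, Set.ncard_image_of_injective _ hinj⟩
  · rwa [Set.ncard_image_of_injective _ hinj]
  · rintro _ ⟨U, hU, rfl⟩
    rw [finrank_comap_surj f hf, h2 U hU, hk]
  · rintro _ ⟨U, hU, rfl⟩ _ ⟨W, hW, rfl⟩ hne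
    have hne' : U ≠ W := fun h => hne (by rw [h])
    rw [← Submodule.comap_inf, finrank_comap_surj f hf, h3 U hU W hW hne', hk, zero_add]

/-- push a sunflower to the quotient by its center. -/
theorem push_code {n m d e : ℕ} (hn : n = m + e) {C : Set (Submodule F (Fin n → F))}
    (hC : IsEquidistantCode F n (d + e) e C) (hS : IsSunflower C) :
    ∃ D : Set (Submodule F (Fin m → F)), IsEquidistantCode F m d 0 D ∧ D.ncard = C.ncard := by
  obtain ⟨h1, h2, h3⟩ := hC
  obtain ⟨Z, hZ⟩ := hS
  have hfin : C.Finite := Set.finite_of_ncard_pos (by omega)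
  have hex : ∀ U ∈ C, ∃ W ∈ C, W ≠ U := fun U hU => Set.exists_ne_of_one_lt_ncard (by omega) U
  have hZU : ∀ U ∈ C, Z ≤ U := by
    intro U hU
    obtain ⟨W, hW, hne⟩ := hex U hU
    rw [← hZ U hU W hW hne.symm]; exact inf_le_left
  have hZe : finrank F Z = e := by
    obtain ⟨U, hU⟩ : C.Nonempty := by
      rw [Set.nonempty_iff_ne_empty]; rintro rfl; simp at h1
    obtain ⟨W, hW, hne⟩ := hex U hU
    rw [← hZ U hU W hW hne.symm]; exact h3 U hU W hW hne.symm
  have hq : finrank F ((Fin n → F) ⧸ Z) = finrank F (Fin m → F) := by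
    have := Submodule.finrank_quotient_add_finrank Z
    simp at this ⊢; omega
  let φ := LinearEquiv.ofFinrankEq _ _ hq
  let f : (Fin n → F) →ₗ[F] (Fin m → F) := φ.toLinearMap ∘ₗ Z.mkQ
  have hf : Function.Surjective f := φ.surjective.comp Z.mkQ_surjective
  have hker : LinearMap.ker f = Z := by
    rw [LinearEquiv.ker_comp, Submodule.ker_mkQ]
  have hcm : ∀ U ∈ C, (U.map f).comap f = U := by
    intro U hU
    rw [Submodule.comap_map_eq, hker, sup_eq_left.2 (hZU U hU)]
  have hinj : Set.InjOn (Submodule.map f) C := by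
    intro U hU W hW h
    rw [← hcm U hU, ← hcm W hW]; exact congrArg _ h
  refine ⟨Submodule.map f '' C, ⟨?_, ?_, ?_⟩, Set.InjOn.ncard_image hinj⟩
  · rwa [Set.InjOn.ncard_image hinj]
  · rintro _ ⟨U, hU, rfl⟩
    have := finrank_comap_surj f hf (U.map f)
    rw [hcm U hU, h2 U hU, hker, hZe] at this
    omega
  · rintro _ ⟨U, hU, rfl⟩ _ ⟨W, hW, rfl⟩ hne
    have hne' : U ≠ W := fun h => hne (by rw [h])
    have := finrank_comap_surj f hf (U.map f ⊓ W.map f)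
    rw [Submodule.comap_inf, hcm U hU, hcm W hW, h3 U hU W hW hne', hker, hZe] at this
    omega

theorem exists_spread [Fintype F] {m d e : ℕ} (hm : m = d + e) (hd : 1 ≤ d) (hde : d ≤ e) :
    ∃ D : Set (Submodule F (Fin m → F)), IsEquidistantCode F m d 0 D ∧
      D.ncard = Fintype.card F ^ e := by
  obtain ⟨p, hp⟩ := CharP.exists F
  have : Fact p.Prime := ⟨CharP.char_is_prime F p⟩
  have : NeZero e := ⟨by omega⟩
  let E := FiniteField.Extension F p e
  have hE : finrank F E = e := FiniteField.finrank_extension F p e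
  have hcard : Nat.card E = Fintype.card F ^ e := by
    rw [FiniteField.natCard_extension, Nat.card_eq_fintype_card]
  have : FiniteDimensional F E := inferInstanceAs (Module.Finite F (FiniteField.Extension F p e))
  obtain ⟨g, hg⟩ : ∃ g : (Fin d → F) →ₗ[F] E, Function.Injective g := by
    let b := Module.finBasis F E
    refine ⟨Fintype.linearCombination F (fun i : Fin d => b (Fin.castLE (by omega) i)), ?_⟩
    exact LinearIndependent.fintypeLinearCombination_injective
      (b.linearIndependent.comp _ (Fin.castLE_injective _))
  have hφ : finrank F ((Fin d → F) × E) = finrank F (Fin m → F) := by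
    rw [Module.finrank_prod, hE]; simp [hm]
  let φ := LinearEquiv.ofFinrankEq _ _ hφ
  let h : E → (Fin d → F) →ₗ[F] (Fin m → F) := fun a =>
    φ.toLinearMap ∘ₗ (LinearMap.prod LinearMap.id (LinearMap.mulLeft F a ∘ₗ g))
  have hh : ∀ a x, h a x = φ (x, a * g x) := fun a x => rfl
  have hhinj : ∀ a, Function.Injective (h a) := by
    intro a x y hxy
    rw [hh, hh] at hxy
    exact (Prod.ext_iff.1 (φ.injective hxy)).1
  have hdim : ∀ a, finrank F (LinearMap.range (h a)) = d := by
    intro a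
    rw [LinearMap.finrank_range_of_inj (hhinj a)]; simp
  have hint : ∀ a b, a ≠ b → LinearMap.range (h a) ⊓ LinearMap.range (h b) = ⊥ := by
    intro a b hab
    rw [eq_bot_iff]
    rintro _ ⟨⟨x, rfl⟩, ⟨y, hy⟩⟩
    rw [hh, hh] at hy
    obtain ⟨h1, h2⟩ := Prod.ext_iff.1 (φ.injective hy)
    simp only at h1 h2
    subst h1
    have h3 : (a - b) * g y = 0 := by rw [sub_mul, h2, sub_self]
    rcases mul_eq_zero.1 h3 with h4 | h4
    · exact absurd (sub_eq_zero.1 h4) hab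
    · have : y = 0 := hg (by rw [h4, map_zero])
      subst this; simp
  have hinj : Function.Injective (fun a => LinearMap.range (h a)) := by
    intro a b hab
    by_contra hne
    have h1 := hint a b hne
    simp only at hab
    rw [← hab, inf_idem] at h1
    have h2 := hdim a
    rw [h1, finrank_bot] at h2
    omega
  have hnc : (Set.range (fun a => LinearMap.range (h a))).ncard = Fintype.card F ^ e := by
    rw [← hcard, ← Set.image_univ, Set.ncard_image_of_injective _ hinj, Set.ncard_univ]
  refine ⟨Set.range (fun a => LinearMap.range (h a)), ⟨?_, ?_, ?_⟩, hnc⟩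
  · rw [hnc]
    calc 2 ≤ Fintype.card F := Fintype.one_lt_card
      _ = Fintype.card F ^ 1 := (pow_one _).symm
      _ ≤ _ := Nat.pow_le_pow_right Fintype.card_pos (by omega)
  · rintro _ ⟨a, rfl⟩; exact hdim a
  · rintro _ ⟨a, rfl⟩ _ ⟨b, rfl⟩ hne
    have : a ≠ b := fun h => hne (by rw [h])
    simp only
    rw [hint a b this, finrank_bot]

theorem code_bdd [Fintype F] (n k c : ℕ) :
    BddAbove {m | ∃ C : Set (Submodule F (Fin n → F)), IsEquidistantCode F n k c C ∧ C.ncard = m} := by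
  refine ⟨Nat.card (Submodule F (Fin n → F)), ?_⟩
  rintro _ ⟨C, _, rfl⟩
  exact Set.ncard_le_card C

theorem le_eMax [Fintype F] {n k c : ℕ} {C : Set (Submodule F (Fin n → F))}
    (hC : IsEquidistantCode F n k c C) : C.ncard ≤ eMax F n k c :=
  le_csSup (code_bdd n k c) ⟨C, hC, rfl⟩

theorem eMax_attained [Fintype F] {n k c : ℕ} {C : Set (Submodule F (Fin n → F))}
    (hC : IsEquidistantCode F n k c C) :
    ∃ C : Set (Submodule F (Fin n → F)), IsEquidistantCode F n k c C ∧ C.ncard = eMax F n k c := by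
  have hne : {m | ∃ C : Set (Submodule F (Fin n → F)),
      IsEquidistantCode F n k c C ∧ C.ncard = m}.Nonempty := ⟨_, C, hC, rfl⟩
  exact Nat.sSup_mem hne (code_bdd n k c)
end C

theorem optimal_code_is_orth_of_sunflower_of_large_q
    (k n c : ℕ) (hk : 1 ≤ k) (hkn : k < n) (hn : 2 * n ≤ 3 * k + 1)
    (hc1 : 2 * k ≤ n + c) (hc2 : c ≤ k - 1) :
    ∃ Q : ℕ, ∀ q : ℕ, IsPrimePow q → Q ≤ q →
      ∀ (F : Type) [Field F] [Fintype F], Fintype.card F = q →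
        eMax F n k c = eMax F (2 * k - c) (k - c) 0 ∧
        ∀ C : Set (Submodule F (Fin n → F)),
          IsEquidistantCode F n k c C → C.ncard = eMax F n k c →
            ∃ S : Set (Submodule F (Fin n → F)),
              (∀ U ∈ S, Module.finrank F U = n - k) ∧ IsSunflower S ∧
              C = stdOrth '' S := by
  refine ⟨4 * (n - k + 2), ?_⟩
  intro q _ hq F _ _ hcard
  classical
  have hqpos : 0 < Fintype.card F := Fintype.card_pos
  have hnm : n = (2 * k - c) + (n + c - 2 * k) := by omega
  have hde : n - k = (k - c) + (n + c - 2 * k) := by omega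
  have hSun : ∀ S : Set (Submodule F (Fin n → F)),
      IsEquidistantCode F n (n - k) (n + c - 2 * k) S → Fintype.card F ^ k ≤ S.ncard →
      IsSunflower S := by
    intro S hS hle
    have hfin : S.Finite := Set.toFinite S
    obtain ⟨Z, hZ⟩ := large_is_sunflower hfin.toFinset (n - k) (n + c - 2 * k) (by omega)
      (fun U hU => hS.2.1 U (by simpa using hU))
      (fun U hU W hW => hS.2.2 U (by simpa using hU) W (by simpa using hW))
      (by omega)
      (by
        rw [← Set.ncard_eq_toFinset_card S hfin]
        exact le_trans (Nat.pow_le_pow_right hqpos (by omega)) hle)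
    exact ⟨Z, fun U hU W hW => hZ U (by simpa using hU) W (by simpa using hW)⟩
  obtain ⟨D0, hD0, hD0c⟩ := exists_spread (F := F) (m := 2 * k - c) (d := k - c) (e := k)
    (by omega) (by omega) (by omega)
  obtain ⟨D, hD, hDc⟩ := eMax_attained hD0
  have hlow : Fintype.card F ^ k ≤ eMax F (2 * k - c) (k - c) 0 := hD0c ▸ le_eMax hD0
  obtain ⟨C1, hC1, hC1c⟩ := pull_code hnm hD
  rw [← hde] at hC1
  have hC0 := orth_code hC1
  have e1 : n - (n - k) = k := by omega
  have e2 : n + (n + c - 2 * k) - 2 * (n - k) = c := by omega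
  rw [e1, e2] at hC0
  have hge : eMax F (2 * k - c) (k - c) 0 ≤ eMax F n k c := by
    have := le_eMax hC0
    rwa [Set.ncard_image_of_injective _ stdOrth_inj, hC1c, hDc] at this
  have hmain : ∀ C : Set (Submodule F (Fin n → F)),
      IsEquidistantCode F n k c C → C.ncard = eMax F n k c → IsSunflower (stdOrth '' C) := by
    intro C hC hCc
    refine hSun _ (orth_code hC) ?_
    rw [Set.ncard_image_of_injective _ stdOrth_inj, hCc]
    exact hlow.trans hge
  refine ⟨le_antisymm ?_ hge, ?_⟩
  · obtain ⟨C, hC, hCc⟩ := eMax_attained hC0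
    have hS := hmain C hC hCc
    have hS' := orth_code hC
    rw [hde] at hS'
    obtain ⟨D2, hD2, hD2c⟩ := push_code hnm hS' hS
    rw [← hCc, ← Set.ncard_image_of_injective C stdOrth_inj, ← hD2c]
    exact le_eMax hD2
  · intro C hC hCc
    refine ⟨stdOrth '' C, (orth_code hC).2.1, hmain C hC hCc, ?_⟩
    rw [Set.image_image]
    simp [stdOrth_stdOrth]
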